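/- Let ν > 0 and ε ∈ ℝ with |ε| < 1, set α = |ε|/ν and ⟨t⟩ = (1+t²)^{1/2}. Let u : ℝ → ℂ be twice continuously differentiable and suppose there is δ > |ε|/(2ν) with ∫_ℝ e^{2δ⟨t⟩}(|u(t)|² + |u′(t)|² + |u″(t)|²) dt < ∞. Set f(t) = u″(t) + (ν² − iε)u(t). Then ( ∫_ℝ e^{α|t|} |u″(t)|² dt )^{1/2} ≤ ((ν² + |ε|)/ν) ( ∫_ℝ |f(t)|² t² e^{α|t|} dt )^{1/2} + ( ∫_ℝ e^{α|t|} |f(t)|² dt )^{1/2}. -/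

import Mathlib

open MeasureTheory Real

lemma hasDerivAt_mul_exp_mul_abs (a t : ℝ) :
    HasDerivAt (fun t : ℝ => t * exp (a * |t|)) ((1 + a * |t|) * exp (a * |t|)) t := by
  rcases lt_trichotomy t 0 with h | rfl | h
  · have := (hasDerivAt_id t).mul (((hasDerivAt_abs_neg h).const_mul a).exp)
    refine this.congr_deriv ?_
    simp [abs_of_neg h]
    ring
  · rw [hasDerivAt_iff_tendsto_slope]
    have hc : Continuous fun t : ℝ => exp (a * |t|) := by fun_prop
    have := (hc.tendsto 0).mono_left (nhdsWithin_le_nhds (s := {0}ᶜ))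
    simp only [abs_zero, mul_zero, exp_zero, add_zero, mul_one] at this ⊢
    refine this.congr' ?_
    filter_upwards [self_mem_nhdsWithin] with x hx
    have hx : x ≠ 0 := hx
    simp [slope_def_field, hx]
  · have := (hasDerivAt_id t).mul (((hasDerivAt_abs_pos h).const_mul a).exp)
    refine this.congr_deriv ?_
    simp [abs_of_pos h]
    ring

/-- A polynomial factor is absorbed by an arbitrarily small loss in the exponential rate. -/
lemma exists_one_add_sq_mul_exp_le {a δ : ℝ} (ha : 0 ≤ a) (h : a < 2 * δ) :
    ∃ C : ℝ, 0 ≤ C ∧ ∀ t : ℝ,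
      (1 + t ^ 2) * exp (a * |t|) ≤ C * exp (2 * δ * √(1 + t ^ 2)) := by
  set κ := 2 * δ - a with hκ
  have hκ0 : 0 < κ := by linarith
  refine ⟨1 + 2 / κ ^ 2, by positivity, fun t => ?_⟩
  have h1 : |t| ≤ √(1 + t ^ 2) := abs_le_sqrt (by linarith)
  have h2 : 1 + t ^ 2 ≤ (1 + 2 / κ ^ 2) * exp (κ * |t|) := by
    have h3 := quadratic_le_exp_of_nonneg (x := κ * |t|) (by positivity)
    have h4 : 0 ≤ κ * |t| := by positivity
    have h5 : t ^ 2 ≤ 2 / κ ^ 2 * exp (κ * |t|) := by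
      calc t ^ 2 = 2 / κ ^ 2 * ((κ * |t|) ^ 2 / 2) := by
            rw [mul_pow, sq_abs]; field_simp
        _ ≤ _ := by gcongr; linarith
    have h6 : 1 ≤ exp (κ * |t|) := one_le_exp h4
    linarith
  calc (1 + t ^ 2) * exp (a * |t|)
      ≤ (1 + 2 / κ ^ 2) * exp (κ * |t|) * exp (a * |t|) := by gcongr
    _ = (1 + 2 / κ ^ 2) * exp (2 * δ * |t|) := by
        rw [mul_assoc, ← exp_add, hκ]; ring_nf
    _ ≤ _ := by gcongr; linarith

/-- Minkowski's inequality in a weighted `L²` space. -/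
lemma sqrt_integral_mul_sq_le {α : Type*} [MeasurableSpace α] {μ : Measure α}
    {w p q r : α → ℝ} {c : ℝ} (hc : 0 ≤ c) (hw : ∀ t, 0 ≤ w t) (hp : ∀ t, 0 ≤ p t)
    (h : ∀ t, p t ≤ c * q t + r t)
    (ip : Integrable (fun t => w t * p t ^ 2) μ) (iq : Integrable (fun t => w t * q t ^ 2) μ)
    (ir : Integrable (fun t => w t * r t ^ 2) μ) :
    √(∫ t, w t * p t ^ 2 ∂μ) ≤ c * √(∫ t, w t * q t ^ 2 ∂μ) + √(∫ t, w t * r t ^ 2 ∂μ) := by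
  set Q := ∫ t, w t * q t ^ 2 ∂μ with hQ
  set R := ∫ t, w t * r t ^ 2 ∂μ with hR
  have hQ0 : 0 ≤ Q := integral_nonneg fun t => mul_nonneg (hw t) (sq_nonneg _)
  have hR0 : 0 ≤ R := integral_nonneg fun t => mul_nonneg (hw t) (sq_nonneg _)
  refine le_of_forall_pos_le_add fun η hη => ?_
  set A := c * √Q + η / 2 with hA
  set B := √R + η / 2 with hB
  have hA0 : 0 < A := by positivity
  have hB0 : 0 < B := by positivity
  have hAQ : c ^ 2 * Q ≤ A ^ 2 := by
    have : (c * √Q) ^ 2 ≤ A ^ 2 := by gcongr; linarith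
    rwa [mul_pow, sq_sqrt hQ0] at this
  have hBR : R ≤ B ^ 2 := by
    have : √R ^ 2 ≤ B ^ 2 := by gcongr; linarith
    rwa [sq_sqrt hR0] at this
  have key : ∫ t, w t * p t ^ 2 ∂μ ≤ (1 + B / A) * c ^ 2 * Q + (1 + A / B) * R := by
    rw [hQ, hR, ← integral_const_mul, ← integral_const_mul,
      ← integral_add (iq.const_mul _) (ir.const_mul _)]
    refine integral_mono ip ((iq.const_mul _).add (ir.const_mul _)) fun t => ?_
    have h1 : p t ^ 2 ≤ (c * q t + r t) ^ 2 := by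
      have := hp t
      gcongr
      exact h t
    have h2 : (c * q t + r t) ^ 2 ≤ (1 + B / A) * c ^ 2 * q t ^ 2 + (1 + A / B) * r t ^ 2 := by
      have : (1 + B / A) * c ^ 2 * q t ^ 2 + (1 + A / B) * r t ^ 2 - (c * q t + r t) ^ 2
          = (B * (c * q t) - A * r t) ^ 2 / (A * B) := by
        field_simp
        ring
      have : 0 ≤ (B * (c * q t) - A * r t) ^ 2 / (A * B) := by positivity
      linarith
    have := mul_le_mul_of_nonneg_left (h1.trans h2) (hw t)
    simp only
    linarith
  have : ∫ t, w t * p t ^ 2 ∂μ ≤ (A + B) ^ 2 := by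
    calc _ ≤ (1 + B / A) * c ^ 2 * Q + (1 + A / B) * R := key
      _ = (1 + B / A) * (c ^ 2 * Q) + (1 + A / B) * R := by ring
      _ ≤ (1 + B / A) * A ^ 2 + (1 + A / B) * B ^ 2 := by gcongr
      _ = (A + B) ^ 2 := by field_simp; ring
  calc _ ≤ A + B := sqrt_le_iff.2 ⟨by positivity, this⟩
    _ = _ := by rw [hA, hB]; ring

/-- The derivative of the energy `‖u'‖² + ν²‖u‖²` along `u'' = f - (ν² - iε)u` is controlled by
the source and by the energy itself. -/
lemma abs_energy_deriv_le {ν : ℝ} (hν : 0 < ν) (ε : ℝ) (x y z : ℂ) :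
    |2 * inner ℝ y z + ν ^ 2 * (2 * inner ℝ x y)| ≤
      2 * ‖z + ((ν : ℂ) ^ 2 - Complex.I * ε) * x‖ * ‖y‖
        + |ε| / ν * (‖y‖ ^ 2 + ν ^ 2 * ‖x‖ ^ 2) := by
  set f := z + ((ν : ℂ) ^ 2 - Complex.I * ε) * x with hf
  have h1 : 2 * inner ℝ y z + ν ^ 2 * (2 * inner ℝ x y)
      = 2 * inner ℝ y f + 2 * inner ℝ y (Complex.I * ε * x) := by
    simp [hf, Complex.inner, ← Complex.ofReal_pow]
    ring
  have h2 := abs_real_inner_le_norm y f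
  have h3 := abs_real_inner_le_norm y (Complex.I * ε * x)
  have h4 : ‖Complex.I * ε * x‖ = |ε| * ‖x‖ := by simp
  have h5 : 2 * (‖y‖ * (|ε| * ‖x‖)) ≤ |ε| / ν * (‖y‖ ^ 2 + ν ^ 2 * ‖x‖ ^ 2) := by
    have h6 : |ε| / ν * (2 * ‖y‖ * (ν * ‖x‖)) = 2 * (‖y‖ * (|ε| * ‖x‖)) := by field_simp
    rw [← h6]
    gcongr
    nlinarith [sq_nonneg (‖y‖ - ν * ‖x‖)]
  rw [h1]
  rw [h4] at h3
  have h7 := abs_add_le (2 * inner ℝ y f) (2 * inner ℝ y (Complex.I * ε * x))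
  rw [abs_mul, abs_mul, abs_two] at h7
  linarith

theorem schrodinger_second_derivative_estimate (ν ε : ℝ) (hν : 0 < ν) (hε : |ε| < 1)
    (u : ℝ → ℂ) (hu : ContDiff ℝ 2 u)
    (hdecay : ∃ δ : ℝ, |ε| / (2 * ν) < δ ∧
      Integrable (fun t : ℝ => Real.exp (2 * δ * Real.sqrt (1 + t ^ 2)) *
        (‖u t‖ ^ 2 + ‖deriv u t‖ ^ 2 + ‖deriv (deriv u) t‖ ^ 2))) :
    Real.sqrt (∫ t : ℝ, Real.exp (|ε| / ν * |t|) * ‖deriv (deriv u) t‖ ^ 2) ≤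
      (ν ^ 2 + |ε|) / ν * Real.sqrt (∫ t : ℝ,
          ‖deriv (deriv u) t + ((ν : ℂ) ^ 2 - Complex.I * ε) * u t‖ ^ 2 *
            t ^ 2 * Real.exp (|ε| / ν * |t|))
      + Real.sqrt (∫ t : ℝ, Real.exp (|ε| / ν * |t|) *
          ‖deriv (deriv u) t + ((ν : ℂ) ^ 2 - Complex.I * ε) * u t‖ ^ 2) := by
  obtain ⟨δ, hδ, hint⟩ := hdecay
  have hbound := abs_energy_deriv_le hν ε
  set a := |ε| / ν with ha
  have ha0 : 0 ≤ a := by positivity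
  have haδ : a < 2 * δ := by
    have : |ε| / (2 * ν) = a / 2 := by rw [ha]; field_simp
    linarith
  have hu1 : ContDiff ℝ 1 (deriv u) :=
    ((contDiff_succ_iff_deriv (n := 1)).1 (by simpa [one_add_one_eq_two] using hu)).2.2
  have cu : Continuous u := hu.continuous
  have cv : Continuous (deriv u) := hu1.continuous
  have cz : Continuous (deriv (deriv u)) := hu1.continuous_deriv le_rfl
  have du : ∀ t, HasDerivAt u (deriv u t) t :=
    fun t => (hu.differentiable two_ne_zero t).hasDerivAt
  have dv : ∀ t, HasDerivAt (deriv u) (deriv (deriv u) t) t :=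
    fun t => (hu1.differentiable one_ne_zero t).hasDerivAt
  set v := deriv u
  set z := deriv v
  set k : ℂ := (ν : ℂ) ^ 2 - Complex.I * ε with hk
  have hkn : ‖k‖ ≤ ν ^ 2 + |ε| := by
    refine (norm_sub_le _ _).trans_eq ?_
    simp
  have hf2 : ∀ t, ‖z t + k * u t‖ ^ 2 ≤ 2 * ‖z t‖ ^ 2 + 2 * ‖k‖ ^ 2 * ‖u t‖ ^ 2 := by
    intro t
    have h1 : ‖z t + k * u t‖ ≤ ‖z t‖ + ‖k‖ * ‖u t‖ := by
      simpa using norm_add_le (z t) (k * u t)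
    have h2 : ‖z t + k * u t‖ ^ 2 ≤ (‖z t‖ + ‖k‖ * ‖u t‖) ^ 2 := by gcongr
    nlinarith [sq_nonneg (‖z t‖ - ‖k‖ * ‖u t‖)]
  set N : ℝ → ℝ := fun t => ‖u t‖ ^ 2 + ‖v t‖ ^ 2 + ‖z t‖ ^ 2 with hN
  have hN0 : ∀ t, 0 ≤ N t := fun t => by positivity
  obtain ⟨C, hC, hCle⟩ := exists_one_add_sq_mul_exp_le ha0 haδ
  have integrable_of_le : ∀ (g : ℝ → ℝ) (K : ℝ), 0 ≤ K → Continuous g →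
      (∀ t, |g t| ≤ K * (1 + t ^ 2) * N t) → Integrable (fun t => exp (a * |t|) * g t) := by
    intro g K hK hg hle
    refine (hint.const_mul (K * C)).mono' (by fun_prop) (.of_forall fun t => ?_)
    rw [norm_mul, norm_of_nonneg (exp_pos _).le, norm_eq_abs]
    calc exp (a * |t|) * |g t| ≤ exp (a * |t|) * (K * (1 + t ^ 2) * N t) := by
          gcongr; exact hle t
      _ = K * ((1 + t ^ 2) * exp (a * |t|)) * N t := by ring
      _ ≤ K * (C * exp (2 * δ * √(1 + t ^ 2))) * N t := by
          exact mul_le_mul_of_nonneg_right (mul_le_mul_of_nonneg_left (hCle t) hK) (hN0 t)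
      _ = _ := by simp only [hN]; ring
  have hNt : ∀ t, N t ≤ (1 + t ^ 2) * N t := fun t =>
    le_mul_of_one_le_left (hN0 t) (by nlinarith)
  have hfN : ∀ t, ‖z t + k * u t‖ ^ 2 ≤ (2 + 2 * ‖k‖ ^ 2) * N t := fun t => by
    refine (hf2 t).trans ?_
    have : 0 ≤ 2 * ‖v t‖ ^ 2 + 2 * ‖u t‖ ^ 2 + 2 * ‖k‖ ^ 2 * (‖v t‖ ^ 2 + ‖z t‖ ^ 2) := by
      positivity
    simp only [hN]
    linarith
  have iz : Integrable fun t => exp (a * |t|) * ‖z t‖ ^ 2 := by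
    refine integrable_of_le _ 1 zero_le_one (by fun_prop) fun t => ?_
    rw [abs_of_nonneg (by positivity), one_mul]
    refine le_trans ?_ (hNt t)
    simp only [hN]
    linarith [sq_nonneg ‖u t‖, sq_nonneg ‖v t‖]
  have iu : Integrable fun t => exp (a * |t|) * ‖u t‖ ^ 2 := by
    refine integrable_of_le _ 1 zero_le_one (by fun_prop) fun t => ?_
    rw [abs_of_nonneg (by positivity), one_mul]
    refine le_trans ?_ (hNt t)
    simp only [hN]
    linarith [sq_nonneg ‖z t‖, sq_nonneg ‖v t‖]
  have i_f : Integrable fun t => exp (a * |t|) * ‖z t + k * u t‖ ^ 2 := by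
    refine integrable_of_le _ (2 + 2 * ‖k‖ ^ 2) (by positivity) (by fun_prop) fun t => ?_
    rw [abs_of_nonneg (by positivity), mul_assoc]
    refine (hfN t).trans ?_
    gcongr
    exact hNt t
  have itf : Integrable fun t => exp (a * |t|) * (‖z t + k * u t‖ ^ 2 * t ^ 2) := by
    refine integrable_of_le _ (2 + 2 * ‖k‖ ^ 2) (by positivity) (by fun_prop) fun t => ?_
    rw [abs_of_nonneg (by positivity)]
    have := hN0 t
    calc ‖z t + k * u t‖ ^ 2 * t ^ 2 ≤ (2 + 2 * ‖k‖ ^ 2) * N t * (1 + t ^ 2) := by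
          gcongr
          · exact hfN t
          · linarith
      _ = _ := by ring
  set E : ℝ → ℝ := fun t => ‖v t‖ ^ 2 + ν ^ 2 * ‖u t‖ ^ 2 with hE
  set E' : ℝ → ℝ := fun t => 2 * inner ℝ (v t) (z t) + ν ^ 2 * (2 * inner ℝ (u t) (v t)) with hE'
  have dE : ∀ t, HasDerivAt E (E' t) t := fun t =>
    (dv t).norm_sq.add ((du t).norm_sq.const_mul (ν ^ 2))
  have cE : Continuous E := by fun_prop
  have cE' : Continuous E' := by fun_prop
  have hE0 : ∀ t, 0 ≤ E t := fun t => by positivity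
  have hEN : ∀ t, E t ≤ (1 + ν ^ 2) * N t := fun t => by
    have : 0 ≤ ‖u t‖ ^ 2 + ‖z t‖ ^ 2 + ν ^ 2 * (‖v t‖ ^ 2 + ‖z t‖ ^ 2) := by positivity
    simp only [hE, hN]
    linarith
  have hE'N : ∀ t, |E' t| ≤ (1 + ν ^ 2) * N t := fun t => by
    have h1 := abs_real_inner_le_norm (v t) (z t)
    have h2 := abs_real_inner_le_norm (u t) (v t)
    have h3 := abs_add_le (2 * inner ℝ (v t) (z t)) (ν ^ 2 * (2 * inner ℝ (u t) (v t)))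
    rw [abs_mul, abs_mul, abs_mul, abs_two, abs_of_nonneg (sq_nonneg ν)] at h3
    have h4 : 2 * |inner ℝ (v t) (z t)| ≤ N t := by
      simp only [hN]
      nlinarith [sq_nonneg (‖v t‖ - ‖z t‖), sq_nonneg ‖u t‖]
    have h5 : 2 * |inner ℝ (u t) (v t)| ≤ N t := by
      simp only [hN]
      nlinarith [sq_nonneg (‖v t‖ - ‖u t‖), sq_nonneg ‖z t‖]
    have h6 := mul_le_mul_of_nonneg_left h5 (sq_nonneg ν)
    simp only [hE']
    linarith
  have habs : ∀ t : ℝ, |t| ≤ 1 + t ^ 2 := fun t => by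
    nlinarith [sq_nonneg (|t| - 1), sq_abs t, abs_nonneg t]
  have iG : Integrable fun t => exp (a * |t|) * (t * E t) := by
    refine integrable_of_le _ (1 + ν ^ 2) (by positivity) (by fun_prop) fun t => ?_
    rw [abs_mul, abs_of_nonneg (hE0 t)]
    have := mul_le_mul (habs t) (hEN t) (hE0 t) (by positivity)
    linarith
  have iG' : Integrable fun t => exp (a * |t|) * ((1 + a * |t|) * E t + t * E' t) := by
    refine integrable_of_le _ ((2 + a) * (1 + ν ^ 2)) (by positivity) (by fun_prop) fun t => ?_
    have h0 : 1 + a * |t| ≤ (1 + a) * (1 + t ^ 2) := by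
      nlinarith [habs t, mul_le_mul_of_nonneg_left (habs t) ha0]
    have h1 := mul_le_mul h0 (hEN t) (hE0 t) (by positivity)
    have h2 := mul_le_mul (habs t) (hE'N t) (abs_nonneg _) (by positivity)
    refine (abs_add_le _ _).trans ?_
    rw [abs_mul, abs_mul, abs_of_nonneg (hE0 t), abs_of_nonneg (by positivity : 0 ≤ 1 + a * |t|)]
    linarith
  have dG : ∀ t, HasDerivAt (fun t => exp (a * |t|) * (t * E t))
      (exp (a * |t|) * ((1 + a * |t|) * E t + t * E' t)) t := fun t => by
    have := (hasDerivAt_mul_exp_mul_abs a t).mul (dE t)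
    refine (this.congr_deriv (by ring)).congr_of_eventuallyEq (.of_forall fun s => ?_)
    simp only [Pi.mul_apply]
    ring
  have hzero := integral_eq_zero_of_hasDerivAt_of_integrable dG iG' iG
  have hle : ν ^ 2 * ∫ t, exp (a * |t|) * ‖u t‖ ^ 2 ≤
      ∫ t, exp (a * |t|) * (‖z t + k * u t‖ ^ 2 * t ^ 2) := by
    rw [← sub_nonpos, ← integral_const_mul, ← integral_sub (iu.const_mul _) itf, ← hzero]
    refine integral_mono ((iu.const_mul _).sub itf) iG' fun t => ?_
    have h1 := hbound (u t) (v t) (z t)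
    have h2 : -(|t| * |E' t|) ≤ t * E' t := by
      rw [← abs_mul]; exact neg_abs_le _
    have h3 := mul_le_mul_of_nonneg_left h1 (abs_nonneg t)
    have h4 := sq_nonneg (‖v t‖ - |t| * ‖z t + k * u t‖)
    have h5 : ν ^ 2 * ‖u t‖ ^ 2 - ‖z t + k * u t‖ ^ 2 * t ^ 2 ≤
        (1 + a * |t|) * E t + t * E' t := by
      rw [← sq_abs t]
      simp only [hE, hE'] at h2 ⊢
      linarith
    have := mul_le_mul_of_nonneg_left h5 (exp_pos (a * |t|)).le
    simp only
    linarith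
  have hsqrt : √(∫ t, exp (a * |t|) * ‖u t‖ ^ 2) ≤
      √(∫ t, exp (a * |t|) * (‖z t + k * u t‖ ^ 2 * t ^ 2)) / ν := by
    rw [le_div_iff₀ hν, mul_comm]
    have := sqrt_le_sqrt hle
    rwa [sqrt_mul (sq_nonneg ν), sqrt_sq hν.le] at this
  have hmin := sqrt_integral_mul_sq_le (μ := volume) (w := fun t : ℝ => exp (a * |t|))
    (p := fun t => ‖z t‖) (q := fun t => ‖u t‖) (r := fun t => ‖z t + k * u t‖)
    (c := ν ^ 2 + |ε|) (by positivity) (fun t => (exp_pos _).le) (fun t => norm_nonneg _)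
    (fun t => by
      have h1 : ‖z t‖ ≤ ‖z t + k * u t‖ + ‖k‖ * ‖u t‖ := by
        simpa using norm_sub_le (z t + k * u t) (k * u t)
      have := mul_le_mul_of_nonneg_right hkn (norm_nonneg (u t))
      linarith) iz iu i_f
  refine hmin.trans ?_
  simp only [mul_comm _ (exp _)]
  rw [div_mul_eq_mul_div, ← mul_div_assoc']
  gcongr
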